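/- arXiv:2102.09994 — 2 statements merged into one kernel-verified Lean document; each statement's English description precedes it below -/
import Mathlib

section
/- There exists a function G : ℕ → ℕ with the following property: for every n ≥ 1, every Δ ∈ ℕ, and every full-dimensional simplex P = {x ∈ ℝⁿ : Ax ≤ b} with A ∈ ℤ^{(n+1)×n}, b ∈ ℝ^{n+1}, and Δ_A ≤ Δ, the ratio of any two facet widths of P satisfies w(a_i, P)/w(a_j, P) ≤ G(Δ), where a_i and a_j are any two rows of A. -/
open Matrix

/-- The width of a set `S ⊆ ℝⁿ` in the direction `v`:
`w(v, S) = sup_{x ∈ S} v·x − inf_{x ∈ S} v·x`. -/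
noncomputable def width {n : ℕ} (v : Fin n → ℝ) (S : Set (Fin n → ℝ)) : ℝ :=
  sSup ((fun x => v ⬝ᵥ x) '' S) - sInf ((fun x => v ⬝ᵥ x) '' S)

/-- The kernel vector of maximal minors: the signed maximal minors of a matrix with `n + 1` rows and
`n` columns give a linear dependency among its rows. -/
lemma sum_signed_minor_mul_eq_zero {n : ℕ} {R : Type*} [CommRing R]
    (A : Matrix (Fin (n + 1)) (Fin n) R) (c : Fin n) :
    ∑ i : Fin (n + 1), (-1) ^ (i : ℕ) * (A.submatrix i.succAbove id).det * A i c = 0 := by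
  let B : Matrix (Fin (n + 1)) (Fin (n + 1)) R := Matrix.of fun i => Fin.cons (A i c) (A i)
  have hB : B.det = 0 :=
    Matrix.det_zero_of_column_eq (i := 0) (j := c.succ) (Fin.succ_ne_zero c).symm
      (fun k => by simp [B])
  rw [Matrix.det_succ_column_zero] at hB
  rw [← hB]
  refine Finset.sum_congr rfl fun i _ => ?_
  have hsub : B.submatrix i.succAbove Fin.succ = A.submatrix i.succAbove id := by
    ext k l
    simp [B]
  rw [hsub]
  simp only [B, Matrix.of_apply, Fin.cons_zero]
  ring

/-- A linear dependency among the rows passes to the products with a vector. -/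
lemma sum_mul_dotProduct_eq_zero {m n : ℕ} {M : Matrix (Fin m) (Fin n) ℝ} {ν : Fin m → ℝ}
    (h : ∀ c, ∑ k, ν k * M k c = 0) (x : Fin n → ℝ) : ∑ k, ν k * (M k ⬝ᵥ x) = 0 := by
  simp only [dotProduct, Finset.mul_sum]
  rw [Finset.sum_comm]
  refine Finset.sum_eq_zero fun c _ => ?_
  rw [← zero_mul (x c), ← h c, Finset.sum_mul]
  exact Finset.sum_congr rfl fun k _ => by ring

/-- If the rows other than row `i` form an invertible matrix, their products with a vector can be
prescribed. -/
lemma exists_dotProduct_eq_of_minor_ne_zero {n : ℕ} {M : Matrix (Fin (n + 1)) (Fin n) ℝ}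
    {i : Fin (n + 1)} (h : (M.submatrix i.succAbove id).det ≠ 0) (c : Fin (n + 1) → ℝ) :
    ∃ y, ∀ k, k ≠ i → M k ⬝ᵥ y = c k := by
  refine ⟨(M.submatrix i.succAbove id)⁻¹ *ᵥ (c ∘ i.succAbove), fun k hk => ?_⟩
  obtain ⟨l, rfl⟩ := Fin.exists_succAbove_eq hk
  have := congrFun (Matrix.mulVec_mulVec (c ∘ i.succAbove) (M.submatrix i.succAbove id)
    (M.submatrix i.succAbove id)⁻¹) l
  rw [Matrix.mul_nonsing_inv _ (isUnit_iff_ne_zero.mpr h), Matrix.one_mulVec] at this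
  exact this

/-- A nonempty bounded polyhedron has no nonzero recession direction. -/
lemma eq_zero_of_isBounded_of_mulVec_nonpos {m n : ℕ} {M : Matrix (Fin m) (Fin n) ℝ}
    {b : Fin m → ℝ} (hbd : Bornology.IsBounded {x | M *ᵥ x ≤ b})
    (hne : {x | M *ᵥ x ≤ b}.Nonempty) {y : Fin n → ℝ} (hy : ∀ k, M k ⬝ᵥ y ≤ 0) : y = 0 := by
  obtain ⟨p, hp⟩ := hne
  obtain ⟨C, hC⟩ := hbd.exists_norm_le
  have hC' : ∀ t : ℕ, (t : ℝ) * ‖y‖ ≤ C + ‖p‖ := fun t => by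
    have hmem : M *ᵥ (p + (t : ℝ) • y) ≤ b := fun k => by
      have h1 : M k ⬝ᵥ p ≤ b k := hp k
      have h2 : (t : ℝ) * (M k ⬝ᵥ y) ≤ 0 := mul_nonpos_of_nonneg_of_nonpos t.cast_nonneg (hy k)
      change M k ⬝ᵥ (p + (t : ℝ) • y) ≤ b k
      rw [dotProduct_add, dotProduct_smul, smul_eq_mul]
      linarith
    calc (t : ℝ) * ‖y‖ = ‖(p + (t : ℝ) • y) - p‖ := by
          rw [add_sub_cancel_left, norm_smul, Real.norm_natCast]
      _ ≤ ‖p + (t : ℝ) • y‖ + ‖p‖ := norm_sub_le _ _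
      _ ≤ C + ‖p‖ := by gcongr; exact hC _ hmem
  by_contra hy0
  have hpos : 0 < ‖y‖ := norm_pos_iff.mpr hy0
  obtain ⟨t, ht⟩ := exists_nat_gt ((C + ‖p‖) / ‖y‖)
  rw [div_lt_iff₀ hpos] at ht
  exact absurd (hC' t) (not_le.mpr ht)

/-- The maximal minors of a matrix defining a simplex do not vanish. -/
lemma minor_ne_zero_of_recession {n : ℕ} {M : Matrix (Fin (n + 1)) (Fin n) ℝ}
    (hrec : ∀ y, (∀ k, M k ⬝ᵥ y ≤ 0) → y = 0) (i : Fin (n + 1)) :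
    (M.submatrix i.succAbove id).det ≠ 0 := by
  intro h
  obtain ⟨y, hy0, hy⟩ := Matrix.exists_mulVec_eq_zero_iff.mpr h
  have hz : ∀ k, k ≠ i → M k ⬝ᵥ y = 0 := fun k hk => by
    obtain ⟨l, rfl⟩ := Fin.exists_succAbove_eq hk
    exact congrFun hy l
  rcases le_total (M i ⬝ᵥ y) 0 with hle | hle
  · refine hy0 (hrec y fun k => ?_)
    by_cases hk : k = i
    · exact hk ▸ hle
    · exact (hz k hk).le
  · refine hy0 (neg_eq_zero.mp (hrec (-y) fun k => ?_))
    rw [dotProduct_neg, neg_nonpos]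
    by_cases hk : k = i
    · exact hk ▸ hle
    · exact (hz k hk).ge

/-- In a linear dependency among the rows of a matrix defining a simplex, all coefficients have the
same sign. -/
lemma coeff_mul_pos_of_recession {n : ℕ} {M : Matrix (Fin (n + 1)) (Fin n) ℝ}
    (hrec : ∀ y, (∀ k, M k ⬝ᵥ y ≤ 0) → y = 0) {μ : Fin (n + 1) → ℝ} (hμ : ∀ k, μ k ≠ 0)
    (hsum : ∀ c, ∑ k, μ k * M k c = 0) (i j : Fin (n + 1)) : 0 < μ i * μ j := by
  by_cases hij : j = i
  · subst hij
    exact mul_self_pos.mpr (hμ j)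
  by_contra hneg
  obtain ⟨y, hy⟩ := exists_dotProduct_eq_of_minor_ne_zero (minor_ne_zero_of_recession hrec i)
    (Pi.single j (-1))
  have hj : M j ⬝ᵥ y = -1 := by simpa using hy j hij
  have hrel : μ i * (M i ⬝ᵥ y) = μ j := by
    have h := sum_mul_dotProduct_eq_zero hsum y
    rw [Finset.sum_eq_add i j (Ne.symm hij) (fun k _ hk => by
      rw [hy k hk.1, Pi.single_eq_of_ne hk.2, mul_zero]) (by simp) (by simp), hj] at h
    linarith
  have hi : M i ⬝ᵥ y ≤ 0 := by
    have hsq : 0 < μ i * μ i := mul_self_pos.mpr (hμ i)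
    have : μ i * μ i * (M i ⬝ᵥ y) ≤ 0 := by
      rw [mul_assoc, hrel]
      exact not_lt.mp hneg
    exact nonpos_of_mul_nonpos_right this hsq
  have hy0 : y = 0 := hrec y fun k => by
    by_cases hk : k = i
    · exact hk ▸ hi
    · rw [hy k hk]
      by_cases hkj : k = j
      · subst hkj
        simp
      · simp [hkj]
  rw [hy0, dotProduct_zero] at hj
  norm_num at hj

/-- The facet widths of a simplex are inversely proportional to the coefficients of the positive
dependency among the facet normals. -/
lemma mul_width_eq_sum {n : ℕ} (hn : 1 ≤ n) {M : Matrix (Fin (n + 1)) (Fin n) ℝ}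
    {b : Fin (n + 1) → ℝ} (hne : {x | M *ᵥ x ≤ b}.Nonempty)
    (hdet : ∀ i : Fin (n + 1), (M.submatrix i.succAbove id).det ≠ 0)
    {ν : Fin (n + 1) → ℝ} (hν : ∀ k, 0 < ν k)
    (hsum : ∀ c, ∑ k, ν k * M k c = 0) (j : Fin (n + 1)) :
    ν j * width (M j) {x | M *ᵥ x ≤ b} = ∑ k, ν k * b k := by
  set S := ∑ k, ν k * b k
  have hslack : ∀ x, ∑ k, ν k * (b k - M k ⬝ᵥ x) = S := fun x => by
    simp only [mul_sub, Finset.sum_sub_distrib]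
    rw [sum_mul_dotProduct_eq_zero hsum x, sub_zero]
  have hS0 : 0 ≤ S := by
    obtain ⟨p, hp⟩ := hne
    rw [← hslack p]
    exact Finset.sum_nonneg fun k _ => mul_nonneg (hν k).le (sub_nonneg.mpr (hp k))
  have hvertex : ∀ i, ∃ v, M *ᵥ v ≤ b ∧ (∀ k, k ≠ i → M k ⬝ᵥ v = b k) ∧
      M i ⬝ᵥ v = b i - S / ν i := fun i => by
    obtain ⟨v, hv⟩ := exists_dotProduct_eq_of_minor_ne_zero (hdet i) b
    have hvi : M i ⬝ᵥ v = b i - S / ν i := by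
      have h := hslack v
      rw [Finset.sum_eq_single i (fun k _ hk => by rw [hv k hk, sub_self, mul_zero])
        (by simp)] at h
      rw [← h, mul_div_cancel_left₀ _ (hν i).ne', sub_sub_cancel]
    refine ⟨v, fun k => ?_, hv, hvi⟩
    change M k ⬝ᵥ v ≤ b k
    by_cases hk : k = i
    · subst hk
      rw [hvi]
      exact sub_le_self _ (div_nonneg hS0 (hν k).le)
    · exact (hv k hk).le
  have hmax : IsGreatest ((fun x => M j ⬝ᵥ x) '' {x | M *ᵥ x ≤ b}) (b j) := by
    have : Nontrivial (Fin (n + 1)) := Fin.nontrivial_iff_two_le.mpr (by omega)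
    obtain ⟨i, hi⟩ := exists_ne j
    obtain ⟨v, hv, hvk, -⟩ := hvertex i
    refine ⟨⟨v, hv, hvk j hi.symm⟩, ?_⟩
    rintro _ ⟨x, hx, rfl⟩
    exact hx j
  have hmin : IsLeast ((fun x => M j ⬝ᵥ x) '' {x | M *ᵥ x ≤ b}) (b j - S / ν j) := by
    obtain ⟨v, hv, -, hvj⟩ := hvertex j
    refine ⟨⟨v, hv, hvj⟩, ?_⟩
    rintro _ ⟨x, hx, rfl⟩
    have hle : ν j * (b j - M j ⬝ᵥ x) ≤ S := by
      rw [← hslack x]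
      exact Finset.single_le_sum (f := fun k => ν k * (b k - M k ⬝ᵥ x))
        (fun k _ => mul_nonneg (hν k).le (sub_nonneg.mpr (hx k))) (Finset.mem_univ j)
    have : b j - M j ⬝ᵥ x ≤ S / ν j := by
      rw [le_div_iff₀ (hν j)]
      linarith
    change b j - S / ν j ≤ M j ⬝ᵥ x
    linarith
  rw [width, hmax.csSup_eq, hmin.csInf_eq, sub_sub_cancel, mul_div_cancel₀ _ (hν j).ne']

/-- There is a function `G : ℕ → ℕ` such that for every `n ≥ 1`, every `Δ ∈ ℕ`, and every
full-dimensional simplex `P = {x ∈ ℝⁿ : Ax ≤ b}` with `A ∈ ℤ^{(n+1)×n}`, `b ∈ ℝ^{n+1}` and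
all `n × n` subdeterminants of `A` bounded in absolute value by `Δ`, the ratio of any two
facet widths of `P` is at most `G(Δ)`: `w(a_i, P) ≤ G(Δ) · w(a_j, P)` for all rows
`a_i, a_j` of `A`. -/
theorem facet_width_ratio_bounded_by_subdet :
    ∃ G : ℕ → ℕ, ∀ n : ℕ, 1 ≤ n → ∀ Δ : ℕ,
      ∀ (A : Matrix (Fin (n + 1)) (Fin n) ℤ) (b : Fin (n + 1) → ℝ)
        (P : Set (Fin n → ℝ)),
        P = {x | (A.map (Int.cast : ℤ → ℝ)).mulVec x ≤ b} →
        Bornology.IsBounded P → (interior P).Nonempty →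
        (∀ g : Fin n ↪ Fin (n + 1), ((A.submatrix g id).det).natAbs ≤ Δ) →
        ∀ i j : Fin (n + 1),
          width ((A.map (Int.cast : ℤ → ℝ)) i) P
            ≤ (G Δ : ℝ) * width ((A.map (Int.cast : ℤ → ℝ)) j) P := by
  refine ⟨id, fun n hn Δ A b P hP hbd hint hΔ i j => ?_⟩
  subst hP
  set M : Matrix (Fin (n + 1)) (Fin n) ℝ := A.map (Int.cast : ℤ → ℝ)
  have hne := hint.mono interior_subset
  have hrec : ∀ y, (∀ k, M k ⬝ᵥ y ≤ 0) → y = 0 := fun y hy =>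
    eq_zero_of_isBounded_of_mulVec_nonpos hbd hne hy
  have hdet := minor_ne_zero_of_recession hrec
  have hcast : ∀ k : Fin (n + 1), (M.submatrix k.succAbove id).det
      = ((A.submatrix k.succAbove id).det : ℝ) := fun k => by
    rw [Int.cast_det]
    rfl
  let μ : Fin (n + 1) → ℝ := fun k => (-1) ^ (k : ℕ) * (M.submatrix k.succAbove id).det
  have hμ : ∀ k, μ k ≠ 0 := fun k => mul_ne_zero (by simp) (hdet k)
  have hμsum : ∀ c, ∑ k, μ k * M k c = 0 := sum_signed_minor_mul_eq_zero M
  have habs : ∀ k, |μ k| = (((A.submatrix k.succAbove id).det).natAbs : ℝ) := fun k => by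
    simp only [μ]
    rw [abs_mul, abs_pow, abs_neg, abs_one, one_pow, one_mul, hcast, Nat.cast_natAbs, Int.cast_abs]
  have hle : ∀ k, |μ k| ≤ Δ := fun k => by
    rw [habs]
    exact_mod_cast hΔ (Fin.succAboveEmb k)
  have hge : ∀ k, 1 ≤ |μ k| := fun k => by
    have h := abs_pos.mpr (hμ k)
    rw [habs] at h ⊢
    exact_mod_cast h
  let ν : Fin (n + 1) → ℝ := fun k => μ k * μ 0
  have hν : ∀ k, 0 < ν k := fun k => coeff_mul_pos_of_recession hrec hμ hμsum k 0
  have hνsum : ∀ c, ∑ k, ν k * M k c = 0 := fun c => by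
    rw [← zero_mul (μ 0), ← hμsum c, Finset.sum_mul]
    exact Finset.sum_congr rfl fun k _ => by simp only [ν]; ring
  have hνabs : ∀ k, ν k = |μ k| * |μ 0| := fun k => by
    rw [← abs_mul, abs_of_pos (hν k)]
  have hratio : ν j ≤ Δ * ν i := by
    rw [hνabs, hνabs, ← mul_assoc]
    refine mul_le_mul_of_nonneg_right ?_ (abs_nonneg _)
    exact (hle j).trans (le_mul_of_one_le_right Δ.cast_nonneg (hge i))
  have hwi := mul_width_eq_sum hn hne hdet hν hνsum i
  have hwj := mul_width_eq_sum hn hne hdet hν hνsum j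
  have hSnonneg : 0 ≤ ∑ k, ν k * b k := by
    obtain ⟨p, hp⟩ := hne
    rw [← sum_mul_dotProduct_eq_zero hνsum p]
    exact Finset.sum_le_sum fun k _ => mul_le_mul_of_nonneg_left (hp k) (hν k).le
  have hwj0 : 0 ≤ width (M j) {x | M *ᵥ x ≤ b} :=
    nonneg_of_mul_nonneg_right (hwj ▸ hSnonneg) (hν j)
  refine le_of_mul_le_mul_left ?_ (hν i)
  calc ν i * width (M i) {x | M *ᵥ x ≤ b} = ν j * width (M j) {x | M *ᵥ x ≤ b} := by rw [hwi, hwj]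
    _ ≤ (Δ * ν i) * width (M j) {x | M *ᵥ x ≤ b} := mul_le_mul_of_nonneg_right hratio hwj0
    _ = ν i * ((id Δ : ℕ) * width (M j) {x | M *ᵥ x ≤ b}) := by rw [id]; ring
end

section
/- Let Δ ∈ ℕ and let S = {x ∈ ℝⁿ : Ax ≤ b} be a full-dimensional simplex with A ∈ ℤ^{(n+1)×n}, b ∈ ℤ^{n+1}, Δ_A ≤ Δ, and every facet width of S at least Δ − 1. For each i ∈ {1, …, n+1}, let A_i x ≤ b^{(i)} be the system obtained from Ax ≤ b by deleting the i-th inequality, defining the simplicial cone C_i = {x ∈ ℝⁿ : A_i x ≤ b^{(i)}}. Then the integer hull of S equals the intersection of the integer hulls of the cones C_i; that is, conv(S ∩ ℤⁿ) = ∩_{i=1}^{n+1} conv(C_i ∩ ℤⁿ). -/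
open Matrix

/-- The integer points of `ℝⁿ`. -/
def intPts (n : ℕ) : Set (Fin n → ℝ) := {x | ∀ i, ∃ z : ℤ, x i = (z : ℝ)}

/-- `Δ_A`: the maximum absolute value of an `n × n` subdeterminant of `A ∈ ℤ^{m×n}`. -/
noncomputable def maxSubdet {m n : ℕ} (A : Matrix (Fin m) (Fin n) ℤ) : ℕ :=
  Finset.univ.sup fun g : Fin n ↪ Fin m => ((A.submatrix g id).det).natAbs

/-- A family of at least `|G|` elements of a finite abelian group `G` has a nonempty subfamily with
zero sum. -/
theorem exists_nonempty_sum_eq_zero_of_card_le {G ι : Type*} [AddCommGroup G] [Finite G]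
    [Fintype ι] (f : ι → G) (h : Nat.card G ≤ Fintype.card ι) :
    ∃ T : Finset ι, T.Nonempty ∧ ∑ i ∈ T, f i = 0 := by
  classical
  have := Fintype.ofFinite G
  rw [Nat.card_eq_fintype_card] at h
  let e := Fintype.equivFin ι
  let P : ℕ → Finset ι := fun k => Finset.univ.filter fun i => (e i : ℕ) < k
  have key : ∀ p q : ℕ, p < q → q ≤ Fintype.card ι → ∑ i ∈ P p, f i = ∑ i ∈ P q, f i →
      ∃ T : Finset ι, T.Nonempty ∧ ∑ i ∈ T, f i = 0 := by
    intro p q hpq hq heq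
    have hsub : P p ⊆ P q := fun i hi => by
      simp only [P, Finset.mem_filter, Finset.mem_univ, true_and] at hi ⊢
      omega
    refine ⟨P q \ P p, ⟨e.symm ⟨p, by omega⟩, by simp [P, hpq]⟩, ?_⟩
    rw [Finset.sum_sdiff_eq_sub hsub, heq, sub_self]
  obtain ⟨p, q, hpq, heq⟩ := Fintype.exists_ne_map_eq_of_card_lt
    (fun k : Fin (Fintype.card ι + 1) => ∑ i ∈ P k, f i) (by simpa using Nat.lt_succ_of_le h)
  rcases lt_or_gt_of_ne hpq with hlt | hlt
  · exact key p q hlt (by omega) heq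
  · exact key q p hlt (by omega) heq.symm

/-- The lattice `M ℤⁿ` has index `|det M|` in `ℤⁿ`. -/
theorem card_quotient_range_mulVecLin {n : ℕ} (M : Matrix (Fin n) (Fin n) ℤ) (hM : M.det ≠ 0) :
    Nat.card ((Fin n → ℤ) ⧸ LinearMap.range M.mulVecLin) = M.det.natAbs := by
  let e := LinearEquiv.ofInjective M.mulVecLin (Matrix.mulVec_injective_of_det_ne_zero hM)
  rw [← Submodule.natAbs_det_equiv _ e, ← LinearMap.det_toLin']
  rfl

/-- If `s ≥ 0` has coordinate sum at least `|det M|`, then the lattice `M ℤⁿ` contains a nonzero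
vector between `0` and `s`. -/
theorem exists_mulVec_between {n : ℕ} (M : Matrix (Fin n) (Fin n) ℤ) (hM : M.det ≠ 0)
    (s : Fin n → ℤ) (hs : 0 ≤ s) (hsum : |M.det| ≤ ∑ j, s j) :
    ∃ w : Fin n → ℤ, 0 ≤ M *ᵥ w ∧ M *ᵥ w ≤ s ∧ 0 < ∑ j, (M *ᵥ w) j := by
  classical
  have hcard := card_quotient_range_mulVecLin M hM
  have : Finite ((Fin n → ℤ) ⧸ LinearMap.range M.mulVecLin) :=
    Nat.finite_of_card_ne_zero (by rw [hcard]; simpa using hM)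
  have hs' : ∀ j, ((s j).toNat : ℤ) = s j := fun j => Int.toNat_of_nonneg (hs j)
  obtain ⟨T, hT, hT0⟩ := exists_nonempty_sum_eq_zero_of_card_le
    (fun i : Σ j, Fin (s j).toNat =>
      (LinearMap.range M.mulVecLin).mkQ (Pi.single i.1 (1 : ℤ))) (by
        rw [hcard]
        zify
        simpa [hs'] using hsum)
  rw [← map_sum, ← LinearMap.mem_ker, Submodule.ker_mkQ] at hT0
  obtain ⟨w, hw⟩ := hT0
  rw [Matrix.mulVecLin_apply] at hw
  have hval : ∀ j, (M *ᵥ w) j = ((T.filter fun i => i.1 = j).card : ℤ) := by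
    intro j
    rw [hw, Finset.sum_apply, Finset.card_filter]
    push_cast
    exact Finset.sum_congr rfl fun i _ => by simp [Pi.single_apply, eq_comm]
  refine ⟨w, fun j => ?_, fun j => ?_, ?_⟩
  · rw [hval]; simp
  · rw [hval, ← hs', Nat.cast_le]
    calc (T.filter fun i => i.1 = j).card
        ≤ ((Finset.univ : Finset (Fin (s j).toNat)).map
            (Function.Embedding.sigmaMk (β := fun j => Fin (s j).toNat) j)).card := by
          refine Finset.card_le_card fun i hi => ?_
          obtain ⟨k, t⟩ := i
          obtain rfl : k = j := (Finset.mem_filter.1 hi).2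
          simp
      _ = (s j).toNat := by simp
  · simp only [hval]
    rw [← Nat.cast_sum, ← Finset.card_eq_sum_card_fiberwise (fun _ _ => Finset.mem_univ _)]
    exact_mod_cast hT.card_pos

/-- Every integer point of a simplicial cone `M z ≤ β` is dominated by an integer point of the cone
with total slack less than `|det M|`. -/
theorem exists_dominating_of_mulVec_le {n : ℕ} (M : Matrix (Fin n) (Fin n) ℤ) (hM : M.det ≠ 0)
    (β z : Fin n → ℤ) (hz : M *ᵥ z ≤ β) :
    ∃ z', M *ᵥ z ≤ M *ᵥ z' ∧ M *ᵥ z' ≤ β ∧ ∑ j, (β - M *ᵥ z') j < |M.det| := by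
  induction hN : (∑ j, (β - M *ᵥ z) j).toNat using Nat.strong_induction_on generalizing z with
  | _ N ih =>
    by_cases hlt : ∑ j, (β - M *ᵥ z) j < |M.det|
    · exact ⟨z, le_rfl, hz, hlt⟩
    · obtain ⟨w, hw0, hws, hwpos⟩ :=
        exists_mulVec_between M hM _ (sub_nonneg.2 hz) (not_lt.1 hlt)
      have hle : M *ᵥ (z + w) ≤ β := by
        rw [Matrix.mulVec_add]
        exact le_sub_iff_add_le'.1 hws
      have hdet : 0 < |M.det| := abs_pos.2 hM
      obtain ⟨z', h1, h2, h3⟩ := ih (∑ j, (β - M *ᵥ (z + w)) j).toNat (by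
        have : ∑ j, (β - M *ᵥ (z + w)) j = ∑ j, (β - M *ᵥ z) j - ∑ j, (M *ᵥ w) j := by
          rw [← Finset.sum_sub_distrib]
          refine Finset.sum_congr rfl fun j _ => ?_
          simp only [Matrix.mulVec_add, Pi.sub_apply, Pi.add_apply]
          ring
        omega) (z + w) hle rfl
      refine ⟨z', le_trans ?_ h1, h2, h3⟩
      rw [Matrix.mulVec_add]
      exact le_add_of_nonneg_right hw0

/-- The alternating maximal minors of `A` form a linear relation between its rows. -/
theorem sum_alternating_det_mul {R : Type*} [CommRing R] {n : ℕ}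
    (A : Matrix (Fin (n + 1)) (Fin n) R) (k : Fin n) :
    ∑ i : Fin (n + 1), (-1) ^ (i : ℕ) * (A.submatrix i.succAbove id).det * A i k = 0 := by
  let B : Matrix (Fin (n + 1)) (Fin (n + 1)) R := Matrix.of fun i => Fin.cons (A i k) (A i)
  have hB : B.det = 0 :=
    Matrix.det_zero_of_column_eq (i := 0) (j := k.succ) (Fin.succ_ne_zero k).symm
      fun i => by simp [B]
  rw [Matrix.det_succ_column_zero] at hB
  rw [← hB]
  refine Finset.sum_congr rfl fun i _ => ?_
  have : B.submatrix i.succAbove Fin.succ = A.submatrix i.succAbove id := by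
    ext; simp [B]
  rw [this]
  simp [B]
  ring

theorem eq_zero_of_mulVec_nonpos_of_isBounded {m n : ℕ} (R : Matrix (Fin m) (Fin n) ℝ)
    (β : Fin m → ℝ) (hbd : Bornology.IsBounded {x | R *ᵥ x ≤ β})
    (hne : {x | R *ᵥ x ≤ β}.Nonempty) (r : Fin n → ℝ) (hr : R *ᵥ r ≤ 0) : r = 0 := by
  obtain ⟨x, hx⟩ := hne
  obtain ⟨C, hC⟩ := hbd.exists_norm_le
  by_contra h0
  have hpos : 0 < ‖r‖ := norm_pos_iff.2 h0
  have hC0 : 0 ≤ C := (norm_nonneg x).trans (hC x hx)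
  have key : ∀ t : ℝ, 0 ≤ t → t * ‖r‖ ≤ C + ‖x‖ := by
    intro t ht
    have hmem : x + t • r ∈ {x | R *ᵥ x ≤ β} := fun i => by
      have h1 := hx i
      have h2 := mul_nonpos_of_nonneg_of_nonpos ht (hr i)
      simp only [Matrix.mulVec_add, Matrix.mulVec_smul, Pi.add_apply, Pi.smul_apply, smul_eq_mul]
      linarith
    calc t * ‖r‖ = ‖t • r‖ := by rw [norm_smul, Real.norm_of_nonneg ht]
      _ = ‖(x + t • r) - x‖ := by rw [add_sub_cancel_left]
      _ ≤ ‖x + t • r‖ + ‖x‖ := norm_sub_le _ _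
      _ ≤ C + ‖x‖ := by gcongr; exact hC _ hmem
  have h := key ((C + ‖x‖ + 1) / ‖r‖) (by positivity)
  rw [div_mul_cancel₀ _ hpos.ne'] at h
  linarith

/-- If `R r ≤ 0` has only the trivial solution, then all maximal minors of `R` are nonzero. -/
theorem det_submatrix_succAbove_ne_zero {n : ℕ} (R : Matrix (Fin (n + 1)) (Fin n) ℝ)
    (hR : ∀ r, R *ᵥ r ≤ 0 → r = 0) (i : Fin (n + 1)) :
    (R.submatrix i.succAbove id).det ≠ 0 := by
  intro h0
  obtain ⟨r, hr0, hr⟩ := Matrix.exists_mulVec_eq_zero_iff.2 h0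
  have hj : ∀ j, (R *ᵥ r) (i.succAbove j) = 0 := fun j => congrFun hr j
  rcases le_total ((R *ᵥ r) i) 0 with h | h
  · refine hr0 (hR r fun k => ?_)
    obtain rfl | ⟨j, rfl⟩ := Fin.eq_self_or_eq_succAbove i k
    · exact h
    · exact (hj j).le
  · refine hr0 (neg_eq_zero.1 (hR (-r) fun k => ?_))
    rw [Matrix.mulVec_neg, Pi.neg_apply, Pi.zero_apply, neg_nonpos]
    obtain rfl | ⟨j, rfl⟩ := Fin.eq_self_or_eq_succAbove i k
    · exact h
    · exact (hj j).ge

/-- If `R r ≤ 0` has only the trivial solution, then the rows of `R` satisfy a positive linear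
relation whose coefficients are the absolute values of the maximal minors. -/
theorem sum_abs_det_mul_eq_zero {n : ℕ} (R : Matrix (Fin (n + 1)) (Fin n) ℝ)
    (hR : ∀ r, R *ᵥ r ≤ 0 → r = 0) (k : Fin n) :
    ∑ i : Fin (n + 1), |(R.submatrix i.succAbove id).det| * R i k = 0 := by
  have hne := det_submatrix_succAbove_ne_zero R hR
  set D : Fin (n + 1) → ℝ := fun i => (-1) ^ (i : ℕ) * (R.submatrix i.succAbove id).det with hD
  have hDne : ∀ i, D i ≠ 0 := fun i => mul_ne_zero (by simp) (hne i)
  have habs : ∀ i, |(R.submatrix i.succAbove id).det| = |D i| := fun i => by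
    simp [hD, abs_mul]
  have hrel : ∀ k, ∑ i, D i * R i k = 0 := sum_alternating_det_mul R
  have hrelv : ∀ r, ∑ i, D i * (R *ᵥ r) i = 0 := fun r => by
    have : D ᵥ* R = 0 := funext hrel
    change D ⬝ᵥ (R *ᵥ r) = 0
    rw [Matrix.dotProduct_mulVec, this, zero_dotProduct]
  have hsign : ∀ i, 0 ≤ D i * D 0 := by
    intro i
    by_contra hneg
    rw [not_le] at hneg
    obtain rfl | ⟨j, rfl⟩ := Fin.eq_self_or_eq_succAbove 0 i
    · exact absurd hneg (not_lt.2 (mul_self_nonneg _))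
    have hunit : IsUnit (R.submatrix (Fin.succAbove 0) id).det := (hne 0).isUnit
    let r : Fin n → ℝ := (R.submatrix (Fin.succAbove 0) id)⁻¹ *ᵥ (-Pi.single j 1)
    have hr : (R.submatrix (Fin.succAbove 0) id) *ᵥ r = -Pi.single j 1 := by
      simp only [r, Matrix.mulVec_mulVec]
      rw [Matrix.mul_nonsing_inv _ hunit, Matrix.one_mulVec]
    have hr' : ∀ l, (R *ᵥ r) ((0 : Fin (n + 1)).succAbove l) = -(Pi.single j 1 : Fin n → ℝ) l :=
      fun l => congrFun hr l
    have h0 : D 0 * (R *ᵥ r) 0 = D ((0 : Fin (n + 1)).succAbove j) := by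
      have := hrelv r
      rw [Fin.sum_univ_succAbove _ 0] at this
      simp only [hr', mul_neg, Finset.sum_neg_distrib, Pi.single_apply, mul_ite, mul_one,
        mul_zero, Finset.sum_ite_eq', Finset.mem_univ, if_true] at this
      linarith
    have hr0 : (R *ᵥ r) 0 ≤ 0 := by
      by_contra hpos
      rw [not_le] at hpos
      rw [← h0] at hneg
      nlinarith [mul_self_nonneg (D 0)]
    have hzero : r = 0 := hR r fun l => by
      obtain rfl | ⟨l, rfl⟩ := Fin.eq_self_or_eq_succAbove 0 l
      · exact hr0
      · rw [hr' l, Pi.zero_apply, neg_nonpos, Pi.single_apply]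
        split_ifs <;> norm_num
    have := hr' j
    rw [hzero] at this
    simp at this
  have hmul : |D 0| * ∑ i, |(R.submatrix i.succAbove id).det| * R i k = 0 := by
    rw [Finset.mul_sum]
    calc ∑ i, |D 0| * (|(R.submatrix i.succAbove id).det| * R i k)
        = ∑ i, D 0 * (D i * R i k) := by
          refine Finset.sum_congr rfl fun i _ => ?_
          rw [habs, ← mul_assoc, ← abs_mul, mul_comm (D 0), abs_of_nonneg (hsign i)]
          ring
      _ = 0 := by rw [← Finset.mul_sum, hrel, mul_zero]
  exact (mul_eq_zero.1 hmul).resolve_left (abs_ne_zero.2 (hDne 0))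

/-- The cones spanned by `n` of the `n + 1` rows cover the space, when the rows satisfy a positive
linear relation. -/
theorem exists_nonneg_vecMul_eq {n : ℕ} (R : Matrix (Fin (n + 1)) (Fin n) ℝ)
    (l : Fin (n + 1) → ℝ) (hl : ∀ i, 0 < l i) (hrel : l ᵥ* R = 0)
    (hdet : (R.submatrix (Fin.succAbove 0) id).det ≠ 0) (c : Fin n → ℝ) :
    ∃ (i : Fin (n + 1)) (ν : Fin (n + 1) → ℝ), 0 ≤ ν ∧ ν i = 0 ∧ ν ᵥ* R = c := by
  let μ' : Fin n → ℝ := c ᵥ* (R.submatrix (Fin.succAbove 0) id)⁻¹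
  have hμ' : μ' ᵥ* (R.submatrix (Fin.succAbove 0) id) = c := by
    simp only [μ', Matrix.vecMul_vecMul]
    rw [Matrix.nonsing_inv_mul _ hdet.isUnit, Matrix.vecMul_one]
  let μ : Fin (n + 1) → ℝ := Fin.cons 0 μ'
  have hμ : μ ᵥ* R = c := by
    rw [← hμ']
    ext k
    simp [Matrix.vecMul, dotProduct, Fin.sum_univ_succ, μ]
  obtain ⟨i, hi⟩ := Finite.exists_min fun j => μ j / l j
  refine ⟨i, μ - (μ i / l i) • l, fun j => ?_, ?_, ?_⟩
  · have := (le_div_iff₀ (hl j)).1 (hi j)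
    simpa using this
  · simp [div_mul_cancel₀ _ (hl i).ne']
  · rw [Matrix.sub_vecMul, Matrix.smul_vecMul, hrel, hμ, smul_zero, sub_zero]

theorem finite_inter_intPts {n : ℕ} {S : Set (Fin n → ℝ)} (hS : Bornology.IsBounded S) :
    (S ∩ intPts n).Finite := by
  obtain ⟨C, hC⟩ := hS.exists_norm_le
  refine ((Set.finite_Icc (fun _ : Fin n => -⌈C⌉) (fun _ => ⌈C⌉)).image
    fun z k => (z k : ℝ)).subset ?_
  rintro x ⟨hxS, hx⟩
  choose z hz using hx
  have hb : ∀ k, |(z k : ℝ)| ≤ ⌈C⌉ := fun k => by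
    rw [← hz, ← Real.norm_eq_abs]
    exact ((norm_le_pi_norm x k).trans (hC x hxS)).trans (Int.le_ceil C)
  refine ⟨z, ⟨fun k => ?_, fun k => ?_⟩, (funext hz).symm⟩
  · exact_mod_cast (abs_le.1 (hb k)).1
  · exact_mod_cast (abs_le.1 (hb k)).2

theorem sum_mul_sub_mulVec {m n : ℕ} (R : Matrix (Fin m) (Fin n) ℝ) (β l : Fin m → ℝ)
    (hrel : l ᵥ* R = 0) (x : Fin n → ℝ) :
    ∑ i, l i * (β i - (R *ᵥ x) i) = ∑ i, l i * β i := by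
  have : l ⬝ᵥ (R *ᵥ x) = 0 := by
    rw [Matrix.dotProduct_mulVec, hrel, zero_dotProduct]
  simp only [mul_sub, Finset.sum_sub_distrib]
  rw [show ∑ i, l i * (R *ᵥ x) i = 0 from this, sub_zero]

/-- The facet widths of a simplex are controlled by a positive linear relation between the rows. -/
theorem mul_width_le {m n : ℕ} (R : Matrix (Fin m) (Fin n) ℝ) (β l : Fin m → ℝ)
    (hl : ∀ i, 0 < l i) (hrel : l ᵥ* R = 0) (hne : {x | R *ᵥ x ≤ β}.Nonempty) (i : Fin m) :
    l i * width (R i) {x | R *ᵥ x ≤ β} ≤ ∑ j, l j * β j := by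
  have hsup : sSup ((fun x => R i ⬝ᵥ x) '' {x | R *ᵥ x ≤ β}) ≤ β i :=
    csSup_le (hne.image _) (by rintro _ ⟨x, hx, rfl⟩; exact hx i)
  have hinf : β i - (∑ j, l j * β j) / l i ≤ sInf ((fun x => R i ⬝ᵥ x) '' {x | R *ᵥ x ≤ β}) := by
    refine le_csInf (hne.image _) ?_
    rintro _ ⟨x, hx, rfl⟩
    have h1 : l i * (β i - (R *ᵥ x) i) ≤ ∑ j, l j * β j := by
      rw [← sum_mul_sub_mulVec R β l hrel x]
      exact Finset.single_le_sum (f := fun j => l j * (β j - (R *ᵥ x) j))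
        (fun j _ => mul_nonneg (hl j).le (sub_nonneg.2 (hx j))) (Finset.mem_univ i)
    have h2 : β i - (R *ᵥ x) i ≤ (∑ j, l j * β j) / l i := by
      rw [le_div_iff₀ (hl i), mul_comm]; exact h1
    change _ ≤ (R *ᵥ x) i
    linarith
  have : width (R i) {x | R *ᵥ x ≤ β} ≤ (∑ j, l j * β j) / l i := by
    unfold width; linarith
  rw [le_div_iff₀ (hl i)] at this
  linarith

theorem abs_det_submatrix_succAbove_le_maxSubdet {n : ℕ} (A : Matrix (Fin (n + 1)) (Fin n) ℤ)
    (i : Fin (n + 1)) : |(A.submatrix i.succAbove id).det| ≤ maxSubdet A := by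
  rw [Int.abs_eq_natAbs, Nat.cast_le]
  exact Finset.le_sup (f := fun g : Fin n ↪ Fin (n + 1) => ((A.submatrix g id).det).natAbs)
    (Finset.mem_univ i.succAboveEmb)

theorem map_intCast_mulVec {m n : ℕ} (A : Matrix (Fin m) (Fin n) ℤ) (z : Fin n → ℤ) (i : Fin m) :
    (A.map (Int.cast : ℤ → ℝ) *ᵥ fun k => (z k : ℝ)) i = ((A *ᵥ z) i : ℝ) := by
  simp [Matrix.mulVec, dotProduct]

theorem det_map_intCast {n : ℕ} (M : Matrix (Fin n) (Fin n) ℤ) :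
    (M.map (Int.cast : ℤ → ℝ)).det = (M.det : ℝ) :=
  ((Int.castRingHom ℝ).map_det M).symm

/-- An integer point of a corner cone with small total slack satisfies the omitted inequality, as
soon as all facet widths of the simplex are large. -/
theorem le_of_sum_slack_lt {n : ℕ} (Δ : ℕ) (b z : Fin (n + 1) → ℤ)
    (l : Fin (n + 1) → ℤ) (hl : ∀ i, 0 < l i) (hlΔ : ∀ i, l i ≤ Δ)
    (hwidth : ∀ i, l i * (Δ - 1) ≤ ∑ j, l j * b j)
    (hrel : ∑ j, l j * (b j - z j) = ∑ j, l j * b j) (i : Fin (n + 1))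
    (hz : ∀ j, z (i.succAbove j) ≤ b (i.succAbove j))
    (hslack : ∑ j, (b (i.succAbove j) - z (i.succAbove j)) < l i) :
    z i ≤ b i := by
  obtain ⟨m, hm⟩ := Finite.exists_max l
  have h1 : ∑ j, l (i.succAbove j) * (b (i.succAbove j) - z (i.succAbove j)) ≤ l m * (Δ - 1) :=
    calc _ ≤ ∑ j, l m * (b (i.succAbove j) - z (i.succAbove j)) :=
          Finset.sum_le_sum fun j _ =>
            mul_le_mul_of_nonneg_right (hm _) (sub_nonneg.2 (hz j))
      _ = l m * ∑ j, (b (i.succAbove j) - z (i.succAbove j)) := by rw [Finset.mul_sum]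
      _ ≤ l m * (Δ - 1) := by
          refine mul_le_mul_of_nonneg_left ?_ (hl m).le
          have := hlΔ i
          omega
  rw [Fin.sum_univ_succAbove _ i] at hrel
  have h2 : 0 ≤ l i * (b i - z i) := by linarith [hwidth m]
  exact sub_nonneg.1 (nonneg_of_mul_nonneg_right h2 (hl i))

/-- Let `S = {x ∈ ℝⁿ : Ax ≤ b}` be a full-dimensional simplex with `A ∈ ℤ^{(n+1)×n}`,
`b ∈ ℤ^{n+1}`, `Δ_A ≤ Δ`, and every facet width at least `Δ − 1`.  For each `i` let
`C_i = {x : A_i x ≤ b^{(i)}}` be the simplicial cone obtained by deleting the `i`-th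
inequality.  Then the integer hull of `S` equals the intersection of the integer hulls of
the cones `C_i`: `conv(S ∩ ℤⁿ) = ∩ᵢ conv(C_i ∩ ℤⁿ)`. -/
theorem integer_hull_eq_inter_corner_integer_hulls {n : ℕ} (hn : 1 ≤ n)
    (Δ : ℕ) (A : Matrix (Fin (n + 1)) (Fin n) ℤ) (b : Fin (n + 1) → ℤ)
    (S : Set (Fin n → ℝ))
    (hS : S = {x | (A.map (Int.cast : ℤ → ℝ)).mulVec x ≤ fun i => (b i : ℝ)})
    (hbd : Bornology.IsBounded S) (hint : (interior S).Nonempty)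
    (hΔ : maxSubdet A ≤ Δ)
    (hwidth : ∀ i : Fin (n + 1), ((Δ : ℝ) - 1) ≤ width ((A.map (Int.cast : ℤ → ℝ)) i) S) :
    convexHull ℝ (S ∩ intPts n)
      = ⋂ i : Fin (n + 1),
          convexHull ℝ
            ({x | ((A.submatrix i.succAbove id).map (Int.cast : ℤ → ℝ)).mulVec x
                ≤ fun k => (b (i.succAbove k) : ℝ)} ∩ intPts n) := by
  subst hS
  set R := A.map (Int.cast : ℤ → ℝ) with hRdef
  set β : Fin (n + 1) → ℝ := fun i => (b i : ℝ) with hβ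
  have hne : {x | R *ᵥ x ≤ β}.Nonempty := hint.mono interior_subset
  have hrec : ∀ r, R *ᵥ r ≤ 0 → r = 0 := eq_zero_of_mulVec_nonpos_of_isBounded R β hbd hne
  let l : Fin (n + 1) → ℤ := fun i => |(A.submatrix i.succAbove id).det|
  have hdetR : ∀ i : Fin (n + 1), (R.submatrix i.succAbove id).det
      = ((A.submatrix i.succAbove id).det : ℝ) := fun i => by
    rw [← det_map_intCast, hRdef, Matrix.submatrix_map]
  have hdet : ∀ i : Fin (n + 1), (A.submatrix i.succAbove id).det ≠ 0 := fun i => by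
    have := det_submatrix_succAbove_ne_zero R hrec i
    rw [hdetR] at this
    exact_mod_cast this
  have hl : ∀ i, 0 < l i := fun i => abs_pos.2 (hdet i)
  have hl' : ∀ i, (0 : ℝ) < l i := fun i => by exact_mod_cast hl i
  have hlΔ : ∀ i, l i ≤ Δ := fun i =>
    (abs_det_submatrix_succAbove_le_maxSubdet A i).trans (by exact_mod_cast hΔ)
  have hrel : (fun i => (l i : ℝ)) ᵥ* R = 0 := by
    ext k
    have := sum_abs_det_mul_eq_zero R hrec k
    simp only [hdetR] at this
    simpa [Matrix.vecMul, dotProduct, l] using this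
  have hσ : ∀ i, l i * (Δ - 1) ≤ ∑ j, l j * b j := fun i => by
    have h := (mul_le_mul_of_nonneg_left (hwidth i) (hl' i).le).trans
      (mul_width_le R β _ hl' hrel hne i)
    simp only [hβ] at h
    exact_mod_cast h
  refine Set.Subset.antisymm (Set.subset_iInter fun i => ?_) fun x hx => ?_
  · exact convexHull_mono (Set.inter_subset_inter_left _ fun x hx k => hx (i.succAbove k))
  by_contra hxS
  obtain ⟨f, u, hfu, hux⟩ := geometric_hahn_banach_closed_point (convex_convexHull ℝ _)
    ((finite_inter_intPts hbd).isClosed_convexHull ℝ) hxS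
  obtain ⟨i, ν, hν, hνi, hνc⟩ := exists_nonneg_vecMul_eq R _ hl' hrel
    (det_submatrix_succAbove_ne_zero R hrec 0) (fun k => f (Pi.single k 1))
  have hf : ∀ y, f y = ∑ j, ν (i.succAbove j) * (R *ᵥ y) (i.succAbove j) := fun y => by
    have h1 : f y = (fun k => f (Pi.single k 1)) ⬝ᵥ y := by
      have h := LinearMap.pi_apply_eq_sum_univ f.toLinearMap y
      simp only [ContinuousLinearMap.coe_coe, smul_eq_mul] at h
      rw [h, dotProduct]
      refine Finset.sum_congr rfl fun k _ => ?_
      rw [mul_comm]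
      congr 2
      ext j
      simp [Pi.single_apply, eq_comm]
    rw [h1, ← hνc, ← Matrix.dotProduct_mulVec, dotProduct, Fin.sum_univ_succAbove _ i, hνi,
      zero_mul, zero_add]
  have hle : f x ≤ u := by
    refine convexHull_min ?_ (convex_halfSpace_le f.toLinearMap.isLinear u) (Set.mem_iInter.1 hx i)
    rintro y ⟨hyC, hyZ⟩
    choose z hz using hyZ
    obtain rfl : y = fun k => (z k : ℝ) := funext hz
    have hzC : A.submatrix i.succAbove id *ᵥ z ≤ fun k => b (i.succAbove k) := fun k => by
      have := hyC k
      rw [map_intCast_mulVec] at this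
      exact Int.cast_le.1 this
    obtain ⟨w, hzw, hwb, hws⟩ := exists_dominating_of_mulVec_le _ (hdet i) _ z hzC
    have hrelw : ∑ j, l j * (b j - (A *ᵥ w) j) = ∑ j, l j * b j := by
      have := sum_mul_sub_mulVec R β _ hrel (fun k => (w k : ℝ))
      simp only [hRdef, map_intCast_mulVec, hβ] at this
      exact_mod_cast this
    have hwi : (A *ᵥ w) i ≤ b i :=
      le_of_sum_slack_lt Δ b (A *ᵥ w) l hl hlΔ hσ hrelw i hwb hws
    have hwS : (fun k => (w k : ℝ)) ∈ {x | R *ᵥ x ≤ β} := fun k => by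
      rw [hRdef, map_intCast_mulVec]
      refine Int.cast_le.2 ?_
      obtain rfl | ⟨j, rfl⟩ := Fin.eq_self_or_eq_succAbove i k
      · exact hwi
      · exact hwb j
    refine le_trans ?_ (hfu _ (subset_convexHull ℝ _ ⟨hwS, fun k => ⟨w k, rfl⟩⟩)).le
    change f _ ≤ f _
    rw [hf, hf]
    refine Finset.sum_le_sum fun j _ => mul_le_mul_of_nonneg_left ?_ (hν _)
    rw [hRdef, map_intCast_mulVec, map_intCast_mulVec]
    exact Int.cast_le.2 (hzw j)
  exact absurd hux (not_lt.2 hle)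
end
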